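/- Let n ≥ 3, κ ≥ 0, and let h be a symmetric n×n matrix with eigenvalues λ₁ ≤ ... ≤ λₙ satisfying λ₁ + λ₂ > 2κ. Let A be any symmetric n×n matrix. Then (d²/ds²) G_κ(h + sA) at s = 0 is nonpositive, where G_κ(h) = (∑_{i<j} 1/(λᵢ(h)+λⱼ(h)-2κ))⁻¹. Moreover, equality holds if and only if A is a scalar multiple of h − κ·I. -/

import Mathlib

open Finset

/-- The fully nonlinear speed `G_κ(h) = (∑_{i<j} 1/(λᵢ(h)+λⱼ(h)-2κ))⁻¹`, defined (with junk
value `0`) on not-necessarily-Hermitian matrices; `λᵢ(h)` are the eigenvalues of `h`. -/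
noncomputable def Gkappa (n : ℕ) (κ : ℝ) (h : Matrix (Fin n) (Fin n) ℝ) : ℝ :=
  if hh : h.IsHermitian then
    (∑ i : Fin n, ∑ j ∈ Finset.univ.filter (fun j => i < j),
      (hh.eigenvalues i + hh.eigenvalues j - 2 * κ)⁻¹)⁻¹
  else 0

open Filter Topology in
/-- The second derivative of `s ↦ 1 / T ((x + s b)⁻¹)` at `0`, for a continuous linear functional
`T` on a complete normed algebra. -/
theorem iteratedDeriv_two_inv_clm_ringInverse {R : Type*} [NormedRing R] [NormedAlgebra ℝ R]
    [CompleteSpace R] (T : R →L[ℝ] ℝ) (x b : R) (hx : IsUnit x) (hT : T (Ring.inverse x) ≠ 0) :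
    iteratedDeriv 2 (fun s : ℝ => (T (Ring.inverse (x + s • b)))⁻¹) 0 =
      2 * T (Ring.inverse x * b * Ring.inverse x) ^ 2 / T (Ring.inverse x) ^ 3 -
      2 * T (Ring.inverse x * b * Ring.inverse x * b * Ring.inverse x) /
        T (Ring.inverse x) ^ 2 := by
  set r : ℝ → R := fun s => Ring.inverse (x + s • b) with hr
  have hr0 : r 0 = Ring.inverse x := by simp [hr]
  have hderiv : ∀ s : ℝ, IsUnit (x + s • b) → HasDerivAt r (-(r s * b * r s)) s := by
    intro s hs
    obtain ⟨u, hu⟩ := hs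
    have h1 : HasDerivAt (fun s : ℝ => x + s • b) b s := by
      simpa using ((hasDerivAt_id s).smul_const b).const_add x
    have h2 := hasFDerivAt_ringInverse (𝕜 := ℝ) u
    rw [hu] at h2
    have h3 := h2.comp_hasDerivAt s h1
    have hus : r s = ↑u⁻¹ := by simp [hr, ← hu]
    rw [hus]
    simpa [Function.comp_def] using! h3
  have hunit : ∀ᶠ s : ℝ in 𝓝 0, IsUnit (x + s • b) := by
    have hc : ContinuousAt (fun s : ℝ => x + s • b) 0 := by fun_prop
    exact hc.eventually (by
    obtain ⟨u, rfl⟩ := hx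
    simpa only [zero_smul, add_zero] using! Units.nhds u)
  have hd0 : HasDerivAt r (-(r 0 * b * r 0)) 0 := hderiv 0 (by simpa using hx)
  have hne : ∀ᶠ s : ℝ in 𝓝 0, T (r s) ≠ 0 := by
    have hc : ContinuousAt (fun s => T (r s)) 0 :=
      T.continuous.continuousAt.comp hd0.continuousAt
    exact hc.eventually_ne (by rwa [hr0])
  have hfirst : deriv (fun s => (T (r s))⁻¹) =ᶠ[𝓝 0]
      fun s => T (r s * b * r s) / T (r s) ^ 2 := by
    filter_upwards [hunit, hne] with s hs hs'
    have h1 : HasDerivAt (fun s => T (r s)) (T (-(r s * b * r s))) s :=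
      T.hasFDerivAt.comp_hasDerivAt s (hderiv s hs)
    have h2 := (h1.fun_inv hs').deriv
    rw [h2, map_neg, neg_neg]
  have hT0 : HasDerivAt (fun s => T (r s)) (T (-(r 0 * b * r 0))) 0 :=
    T.hasFDerivAt.comp_hasDerivAt 0 hd0
  have hN0 : HasDerivAt (fun s => T (r s * b * r s))
      (T (-(r 0 * b * r 0) * b * r 0 + r 0 * b * -(r 0 * b * r 0))) 0 :=
    T.hasFDerivAt.comp_hasDerivAt 0 ((hd0.mul_const b).mul hd0)
  have hquot := (hN0.fun_div (hT0.fun_pow 2) (pow_ne_zero 2 hne.self_of_nhds)).deriv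
  rw [iteratedDeriv_succ, iteratedDeriv_one, hfirst.deriv_eq, hquot, hr0]
  simp only [neg_mul, mul_neg, map_neg, map_add, ← mul_assoc]
  field_simp
  push_cast
  ring

namespace Matrix

variable {ι : Type*} [Fintype ι] [DecidableEq ι]

open scoped Norms.Operator in
theorem eventually_isUnit_add_smul (K B : Matrix ι ι ℝ) (hK : IsUnit K) :
    ∀ᶠ s : ℝ in nhds 0, IsUnit (K + s • B) := by
  have hc : ContinuousAt (fun s : ℝ => K + s • B) 0 := by fun_prop
  exact hc.eventually (by
    obtain ⟨u, rfl⟩ := hK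
    simpa only [zero_smul, add_zero] using! Units.nhds u)

open scoped Norms.Operator in
theorem iteratedDeriv_two_inv_trace_inv (K B : Matrix ι ι ℝ) (hK : IsUnit K)
    (hT : K⁻¹.trace ≠ 0) :
    iteratedDeriv 2 (fun s : ℝ => ((K + s • B)⁻¹.trace)⁻¹) 0 =
      2 * (K⁻¹ * B * K⁻¹).trace ^ 2 / K⁻¹.trace ^ 3 -
      2 * (K⁻¹ * B * K⁻¹ * B * K⁻¹).trace / K⁻¹.trace ^ 2 := by
  simp only [nonsing_inv_eq_ringInverse] at hT ⊢
  exact iteratedDeriv_two_inv_clm_ringInverse (traceLinearMap ι ℝ ℝ).toContinuousLinearMap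
    K B hK hT

theorem PosDef.trace_conjTranspose_mul_mul_same_eq_zero_iff {R : Matrix ι ι ℝ} (hR : R.PosDef)
    (Z : Matrix ι ι ℝ) : (Zᴴ * R * Z).trace = 0 ↔ Z = 0 := by
  refine ⟨fun h => ?_, fun h => by simp [h]⟩
  rw [(hR.posSemidef.conjTranspose_mul_mul_same Z).trace_eq_zero_iff] at h
  by_contra hZ
  obtain ⟨v, hv⟩ : ∃ v, Z *ᵥ v ≠ 0 := by
    by_contra! hv
    exact hZ (ext_of_mulVec_single fun i => by rw [hv, zero_mulVec])
  have := hR.dotProduct_mulVec_pos hv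
  rw [star_mulVec, ← dotProduct_mulVec, mulVec_mulVec, mulVec_mulVec, h] at this
  simp at this

/-- Cauchy–Schwarz for the trace form `(X, Y) ↦ tr (Xᵀ K⁻¹ Y)`, applied to `1` and `B K⁻¹`. -/
theorem PosDef.trace_inv_mul_sq_le {K B : Matrix ι ι ℝ} [Nonempty ι] (hK : K.PosDef)
    (hB : B.IsHermitian) :
    (K⁻¹ * B * K⁻¹).trace ^ 2 ≤ K⁻¹.trace * (K⁻¹ * B * K⁻¹ * B * K⁻¹).trace ∧
    ((K⁻¹ * B * K⁻¹).trace ^ 2 = K⁻¹.trace * (K⁻¹ * B * K⁻¹ * B * K⁻¹).trace ↔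
      ∃ c : ℝ, B = c • K) := by
  have hR := hK.inv
  have hu : IsUnit K.det := (isUnit_iff_isUnit_det K).1 hK.isUnit
  have hpos : 0 < K⁻¹.trace := hR.trace_pos
  set t : ℝ := (K⁻¹ * B * K⁻¹).trace / K⁻¹.trace with ht
  set Z := B * K⁻¹ - t • (1 : Matrix ι ι ℝ) with hZ
  have key : K⁻¹.trace * (Zᴴ * K⁻¹ * Z).trace =
      K⁻¹.trace * (K⁻¹ * B * K⁻¹ * B * K⁻¹).trace - (K⁻¹ * B * K⁻¹).trace ^ 2 := by
    have hZt : Zᴴ = K⁻¹ * B - t • (1 : Matrix ι ι ℝ) := by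
      simp [hZ, conjTranspose_mul, hB.eq, hR.isHermitian.eq, -conjTranspose_eq_transpose_of_trivial]
    have h1 : (B * K⁻¹ * K⁻¹).trace = (K⁻¹ * B * K⁻¹).trace := by
      rw [trace_mul_comm, Matrix.mul_assoc]
    rw [hZt, hZ]
    simp only [Matrix.sub_mul, Matrix.mul_sub, trace_sub, smul_mul_assoc, mul_smul_comm, trace_smul,
      Matrix.one_mul, Matrix.mul_one, smul_eq_mul, ← Matrix.mul_assoc]
    rw [ht]
    field_simp
    ring
  have hnn := (hR.posSemidef.conjTranspose_mul_mul_same Z).trace_nonneg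
  refine ⟨by nlinarith [mul_nonneg hpos.le hnn], ?_, ?_⟩
  · intro h
    have h0 : (Zᴴ * K⁻¹ * Z).trace = 0 := by
      have : K⁻¹.trace * (Zᴴ * K⁻¹ * Z).trace = 0 := by rw [key, h, sub_self]
      exact (mul_eq_zero.1 this).resolve_left hpos.ne'
    rw [hR.trace_conjTranspose_mul_mul_same_eq_zero_iff, hZ, sub_eq_zero] at h0
    refine ⟨t, ?_⟩
    calc B = B * K⁻¹ * K := by rw [nonsing_inv_mul_cancel_right _ _ hu]
      _ = t • K := by rw [h0, smul_mul_assoc, Matrix.one_mul]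
  · rintro ⟨c, rfl⟩
    simp only [mul_smul_comm, smul_mul_assoc, nonsing_inv_mul _ hu, Matrix.one_mul, trace_smul,
      smul_eq_mul]
    ring

/-- `s ↦ 1 / tr ((K + s B)⁻¹)` is concave at a positive definite `K`, and degenerate exactly in the
radial direction. -/
theorem PosDef.iteratedDeriv_two_inv_trace_inv {K B : Matrix ι ι ℝ} [Nonempty ι] (hK : K.PosDef)
    (hB : B.IsHermitian) :
    iteratedDeriv 2 (fun s : ℝ => ((K + s • B)⁻¹.trace)⁻¹) 0 ≤ 0 ∧
    (iteratedDeriv 2 (fun s : ℝ => ((K + s • B)⁻¹.trace)⁻¹) 0 = 0 ↔ ∃ c : ℝ, B = c • K) := by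
  have hpos : 0 < K⁻¹.trace := hK.inv.trace_pos
  obtain ⟨hle, heq⟩ := hK.trace_inv_mul_sq_le hB
  have hform : iteratedDeriv 2 (fun s : ℝ => ((K + s • B)⁻¹.trace)⁻¹) 0 =
      2 / K⁻¹.trace ^ 3 * ((K⁻¹ * B * K⁻¹).trace ^ 2 -
        K⁻¹.trace * (K⁻¹ * B * K⁻¹ * B * K⁻¹).trace) := by
    rw [Matrix.iteratedDeriv_two_inv_trace_inv K B hK.isUnit hpos.ne']
    field_simp
  rw [hform, ← heq, mul_eq_zero, sub_eq_zero, or_iff_right (by positivity)]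
  exact ⟨mul_nonpos_of_nonneg_of_nonpos (by positivity) (sub_nonpos.2 hle), Iff.rfl⟩

section SkewCompress

variable {m : Type*} [LinearOrder m] [Fintype m]

/-- The matrix whose columns are the skew-symmetric tensors `eᵢ ⊗ eⱼ - eⱼ ⊗ eᵢ` for `i < j`. -/
def skewBasis (m : Type*) [LinearOrder m] : Matrix (m × m) {p : m × m // p.1 < p.2} ℝ :=
  of fun a p => (if a = p.1 then 1 else 0) - if a = p.1.swap then 1 else 0

theorem skewBasis_transpose_mul_mul_apply (M : Matrix (m × m) (m × m) ℝ)
    (p q : {p : m × m // p.1 < p.2}) :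
    ((skewBasis m)ᵀ * M * skewBasis m) p q =
      M p.1 q.1 - M p.1.swap q.1 - (M p.1 q.1.swap - M p.1.swap q.1.swap) := by
  simp [Matrix.mul_apply, skewBasis, sub_mul, mul_sub, Finset.sum_sub_distrib]

theorem skewBasis_transpose_mul_self : (skewBasis m)ᵀ * skewBasis m = (2 : ℝ) • 1 := by
  ext p q
  have h := skewBasis_transpose_mul_mul_apply 1 p q
  rw [Matrix.mul_one] at h
  obtain ⟨⟨i, j⟩, hij⟩ := p
  obtain ⟨⟨k, l⟩, hkl⟩ := q
  rw [h]
  simp only [one_apply, smul_apply, smul_eq_mul, Prod.swap_prod_mk, Prod.mk.injEq,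
    Subtype.mk.injEq] at *
  grind

theorem skewBasis_mul_transpose_apply (a b : m × m) :
    (skewBasis m * (skewBasis m)ᵀ) a b =
      (if a = b then 1 else 0) - if a = b.swap then 1 else 0 := by
  obtain ⟨i, j⟩ := a
  obtain ⟨k, l⟩ := b
  simp only [Matrix.mul_apply, transpose_apply, skewBasis, of_apply]
  rcases lt_trichotomy i j with hij | rfl | hij
  · rw [Finset.sum_eq_single ⟨(i, j), hij⟩ (by grind) (by simp)]
    grind
  · rw [Finset.sum_eq_zero (by grind)]
    grind
  · rw [Finset.sum_eq_single ⟨(j, i), hij⟩ (by grind) (by simp)]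
    grind

open scoped Kronecker

theorem skewBasis_mul_transpose_mul_apply (M : Matrix (m × m) (m × m) ℝ) (a b : m × m) :
    (skewBasis m * (skewBasis m)ᵀ * M) a b = M a b - M a.swap b := by
  have hswap : ∀ x : m × m, a = x.swap ↔ a.swap = x := fun x => by
    rw [eq_comm, Prod.swap_eq_iff_eq_swap, eq_comm]
  simp [Matrix.mul_apply (M := skewBasis m * (skewBasis m)ᵀ), skewBasis_mul_transpose_apply,
    sub_mul, Finset.sum_sub_distrib, hswap]

theorem mul_skewBasis_mul_transpose_apply (M : Matrix (m × m) (m × m) ℝ) (a b : m × m) :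
    (M * (skewBasis m * (skewBasis m)ᵀ)) a b = M a b - M a b.swap := by
  simp [Matrix.mul_apply (N := skewBasis m * (skewBasis m)ᵀ), skewBasis_mul_transpose_apply,
    mul_sub, Finset.sum_sub_distrib]

theorem commute_skewBasis_mul_transpose_kronecker (U : Matrix m m ℝ) :
    Commute (skewBasis m * (skewBasis m)ᵀ) (U ⊗ₖ U) := by
  rw [commute_iff_eq]
  ext ⟨i, j⟩ ⟨k, l⟩
  rw [skewBasis_mul_transpose_mul_apply, mul_skewBasis_mul_transpose_apply]
  simp [mul_comm]

/-- The second multiplicative compound of `U`, the matrix of its `2 × 2` minors. -/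
noncomputable def compoundTwo (U : Matrix m m ℝ) :
    Matrix {p : m × m // p.1 < p.2} {p : m × m // p.1 < p.2} ℝ :=
  (2⁻¹ : ℝ) • ((skewBasis m)ᵀ * (U ⊗ₖ U) * skewBasis m)

/-- The second additive compound of `X`, the matrix of the derivation induced by `X` on the
exterior square. -/
noncomputable def addCompoundTwo :
    Matrix m m ℝ →ₗ[ℝ] Matrix {p : m × m // p.1 < p.2} {p : m × m // p.1 < p.2} ℝ where
  toFun X := (skewBasis m)ᵀ * (X ⊗ₖ (1 : Matrix m m ℝ)) * skewBasis m
  map_add' X Y := by simp only [add_kronecker, Matrix.mul_add, Matrix.add_mul]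
  map_smul' c X := by
    simp only [smul_kronecker, Matrix.mul_smul, Matrix.smul_mul, RingHom.id_apply]

theorem addCompoundTwo_apply (X : Matrix m m ℝ) :
    addCompoundTwo X = (skewBasis m)ᵀ * (X ⊗ₖ (1 : Matrix m m ℝ)) * skewBasis m := rfl

theorem skewBasis_transpose_mul_kronecker (U : Matrix m m ℝ) :
    (skewBasis m)ᵀ * (U ⊗ₖ U) = compoundTwo U * (skewBasis m)ᵀ := by
  have h := (commute_skewBasis_mul_transpose_kronecker U).eq
  have h2 := congrArg (fun M => (2⁻¹ : ℝ) • ((skewBasis m)ᵀ * M)) h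
  simp only [← Matrix.mul_assoc, skewBasis_transpose_mul_self] at h2
  simpa [compoundTwo, Matrix.mul_assoc] using h2

theorem kronecker_mul_skewBasis (U : Matrix m m ℝ) :
    (U ⊗ₖ U) * skewBasis m = skewBasis m * compoundTwo U := by
  have h := (commute_skewBasis_mul_transpose_kronecker U).eq
  have h2 := congrArg (fun M => (2⁻¹ : ℝ) • (M * skewBasis m)) h
  simp only [Matrix.mul_assoc, skewBasis_transpose_mul_self] at h2
  simpa [compoundTwo, Matrix.mul_assoc] using h2.symm

theorem compoundTwo_mul (U V : Matrix m m ℝ) :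
    compoundTwo (U * V) = compoundTwo U * compoundTwo V := by
  rw [compoundTwo, mul_kronecker_mul, ← Matrix.mul_assoc, skewBasis_transpose_mul_kronecker,
    Matrix.mul_assoc, Matrix.mul_assoc, ← Matrix.mul_assoc _ᵀ, compoundTwo.eq_def V, mul_smul_comm]

theorem compoundTwo_one : compoundTwo (1 : Matrix m m ℝ) = 1 := by
  rw [compoundTwo, one_kronecker_one, Matrix.mul_one, skewBasis_transpose_mul_self, smul_smul]
  norm_num

theorem compoundTwo_transpose (U : Matrix m m ℝ) : compoundTwo Uᵀ = (compoundTwo U)ᵀ := by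
  simp [compoundTwo, transpose_mul, Matrix.mul_assoc, kroneckerMap_transpose]

theorem addCompoundTwo_transpose (X : Matrix m m ℝ) :
    addCompoundTwo Xᵀ = (addCompoundTwo X)ᵀ := by
  simp [addCompoundTwo_apply, transpose_mul, Matrix.mul_assoc, ← kroneckerMap_transpose]

theorem addCompoundTwo_conj {U V : Matrix m m ℝ} (hUV : U * V = 1) (X : Matrix m m ℝ) :
    addCompoundTwo (U * X * V) = compoundTwo U * addCompoundTwo X * compoundTwo V := by
  have h : (U * X * V) ⊗ₖ (1 : Matrix m m ℝ) = (U ⊗ₖ U) * (X ⊗ₖ 1) * (V ⊗ₖ V) := by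
    rw [← mul_kronecker_mul, ← mul_kronecker_mul, Matrix.mul_one, hUV]
  rw [addCompoundTwo_apply, addCompoundTwo_apply, h]
  simp only [← Matrix.mul_assoc, skewBasis_transpose_mul_kronecker]
  simp only [Matrix.mul_assoc, kronecker_mul_skewBasis]

theorem addCompoundTwo_diagonal (d : m → ℝ) :
    addCompoundTwo (diagonal d) =
      diagonal fun p : {p : m × m // p.1 < p.2} => d p.1.1 + d p.1.2 := by
  ext ⟨⟨i, j⟩, hij⟩ ⟨⟨k, l⟩, hkl⟩
  rw [addCompoundTwo_apply, skewBasis_transpose_mul_mul_apply]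
  simp only [kronecker_apply, diagonal_apply, one_apply, Prod.swap_prod_mk, Subtype.mk.injEq,
    Prod.mk.injEq] at *
  grind

theorem addCompoundTwo_injective (hm : 3 ≤ Fintype.card m) :
    Function.Injective (addCompoundTwo (m := m)) := by
  rw [injective_iff_map_eq_zero]
  intro X hX
  have hE : ∀ i j k l : m, X i k * (1 : Matrix m m ℝ) j l - X j k * (1 : Matrix m m ℝ) i l -
      (X i l * (1 : Matrix m m ℝ) j k - X j l * (1 : Matrix m m ℝ) i k) = 0 := by
    have hlt : ∀ i j k l : m, i < j → k < l →
        X i k * (1 : Matrix m m ℝ) j l - X j k * (1 : Matrix m m ℝ) i l -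
        (X i l * (1 : Matrix m m ℝ) j k - X j l * (1 : Matrix m m ℝ) i k) = 0 := by
      intro i j k l hij hkl
      have := skewBasis_transpose_mul_mul_apply (X ⊗ₖ (1 : Matrix m m ℝ)) ⟨(i, j), hij⟩
        ⟨(k, l), hkl⟩
      rw [← addCompoundTwo_apply, hX] at this
      simpa using this.symm
    intro i j k l
    rcases lt_trichotomy i j with hij | rfl | hij <;>
    rcases lt_trichotomy k l with hkl | rfl | hkl <;> grind
  have hoff : ∀ i k, i ≠ k → X i k = 0 := by
    intro i k hik
    obtain ⟨j, hj⟩ := Finset.exists_mem_notMem_of_card_lt_card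
      (s := {i, k}) (t := Finset.univ)
      (Finset.card_le_two.trans_lt (by rwa [Finset.card_univ]))
    have := hE i j k j
    simp [one_apply] at this hj
    grind
  have hdiag : ∀ i j, i ≠ j → X i i + X j j = 0 := by
    intro i j hij
    have := hE i j i j
    simp [one_apply] at this
    grind
  ext i k
  by_cases hik : i = k
  · subst hik
    obtain ⟨j, -, hj⟩ := Finset.exists_mem_notMem_of_card_lt_card
      (s := {i}) (t := Finset.univ) (by rw [Finset.card_univ, Finset.card_singleton]; omega)
    obtain ⟨l, -, hl⟩ := Finset.exists_mem_notMem_of_card_lt_card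
      (s := {i, j}) (t := Finset.univ)
      (Finset.card_le_two.trans_lt (by rwa [Finset.card_univ]))
    have h1 := hdiag i j
    have h2 := hdiag i l
    have h3 := hdiag j l
    simp at hj hl ⊢
    grind
  · simpa using hoff i k hik

end SkewCompress

section Spectral

variable {m : Type*} [LinearOrder m] [Fintype m]

theorem IsHermitian.compoundTwo_eigenvectorUnitary_mul_transpose {M : Matrix m m ℝ}
    (hM : M.IsHermitian) :
    compoundTwo (hM.eigenvectorUnitary : Matrix m m ℝ) *
      (compoundTwo (hM.eigenvectorUnitary : Matrix m m ℝ))ᵀ = 1 := by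
  rw [← compoundTwo_transpose, ← compoundTwo_mul, ← conjTranspose_eq_transpose_of_trivial,
    ← star_eq_conjTranspose, mem_unitaryGroup_iff.1 hM.eigenvectorUnitary.2, compoundTwo_one]

/-- The second additive compound of `M - κ I` is orthogonally diagonalised by the compound of an
eigenbasis of `M`, with eigenvalues `λᵢ + λⱼ - 2κ` for `i < j`. -/
theorem IsHermitian.addCompoundTwo_sub_smul_one {M : Matrix m m ℝ} (hM : M.IsHermitian) (κ : ℝ) :
    addCompoundTwo (M - κ • (1 : Matrix m m ℝ)) =
      compoundTwo (hM.eigenvectorUnitary : Matrix m m ℝ) *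
        diagonal (fun p : {p : m × m // p.1 < p.2} =>
          hM.eigenvalues p.1.1 + hM.eigenvalues p.1.2 - 2 * κ) *
        (compoundTwo (hM.eigenvectorUnitary : Matrix m m ℝ))ᵀ := by
  have hUU := mem_unitaryGroup_iff.1 hM.eigenvectorUnitary.2
  have hspec : M = (hM.eigenvectorUnitary : Matrix m m ℝ) * diagonal hM.eigenvalues *
      star (hM.eigenvectorUnitary : Matrix m m ℝ) := by
    conv_lhs => rw [hM.spectral_theorem, Unitary.conjStarAlgAut_apply]
    rfl
  set U : Matrix m m ℝ := (hM.eigenvectorUnitary : Matrix m m ℝ)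
  have hshift : M - κ • (1 : Matrix m m ℝ) =
      U * diagonal (fun i => hM.eigenvalues i - κ) * star U := by
    have hd : diagonal (fun i => hM.eigenvalues i - κ) =
        diagonal hM.eigenvalues - κ • (1 : Matrix m m ℝ) := by
      rw [smul_one_eq_diagonal, diagonal_sub]
    rw [hd, Matrix.mul_sub, Matrix.sub_mul, ← hspec, mul_smul_comm, smul_mul_assoc,
      Matrix.mul_one, hUU]
  rw [hshift, addCompoundTwo_conj hUU, addCompoundTwo_diagonal, ← compoundTwo_transpose,
    star_eq_conjTranspose, conjTranspose_eq_transpose_of_trivial]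
  congr 3
  ext p
  ring

theorem IsHermitian.posDef_addCompoundTwo {M : Matrix m m ℝ} (hM : M.IsHermitian) {κ : ℝ}
    (hdom : ∀ i j : m, i ≠ j → hM.eigenvalues i + hM.eigenvalues j > 2 * κ) :
    (addCompoundTwo (M - κ • (1 : Matrix m m ℝ))).PosDef := by
  have hCC := hM.compoundTwo_eigenvectorUnitary_mul_transpose
  rw [hM.addCompoundTwo_sub_smul_one κ, ← conjTranspose_eq_transpose_of_trivial,
    ← star_eq_conjTranspose, IsUnit.posDef_star_right_conjugate_iff (.of_mul_eq_one _ hCC)]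
  exact PosDef.diagonal fun p => sub_pos.2 (hdom _ _ p.2.ne)

theorem IsHermitian.trace_inv_addCompoundTwo {M : Matrix m m ℝ} (hM : M.IsHermitian) {κ : ℝ}
    (hu : IsUnit (addCompoundTwo (M - κ • (1 : Matrix m m ℝ)))) :
    (addCompoundTwo (M - κ • (1 : Matrix m m ℝ)))⁻¹.trace =
      ∑ p : {p : m × m // p.1 < p.2},
        (hM.eigenvalues p.1.1 + hM.eigenvalues p.1.2 - 2 * κ)⁻¹ := by
  have hCC := hM.compoundTwo_eigenvectorUnitary_mul_transpose
  rw [hM.addCompoundTwo_sub_smul_one κ] at hu ⊢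
  set C := compoundTwo (hM.eigenvectorUnitary : Matrix m m ℝ)
  have hCC' : Cᵀ * C = 1 := mul_eq_one_comm.1 hCC
  have hd : IsUnit (diagonal fun p : {p : m × m // p.1 < p.2} =>
      hM.eigenvalues p.1.1 + hM.eigenvalues p.1.2 - 2 * κ) := by
    have hC : IsUnit C := .of_mul_eq_one _ hCC
    have hC' : IsUnit Cᵀ := .of_mul_eq_one _ hCC'
    rwa [hC'.mul_right_iff, hC.mul_left_iff] at hu
  rw [Matrix.mul_inv_rev, Matrix.mul_inv_rev, inv_eq_right_inv hCC, inv_eq_right_inv hCC',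
    trace_mul_comm, Matrix.mul_assoc, hCC', Matrix.mul_one]
  rw [isUnit_diagonal, Pi.isUnit_iff] at hd
  rw [inv_eq_right_inv (B := diagonal fun p : {p : m × m // p.1 < p.2} =>
      (hM.eigenvalues p.1.1 + hM.eigenvalues p.1.2 - 2 * κ)⁻¹), trace_diagonal]
  rw [diagonal_mul_diagonal, ← diagonal_one]
  congr 1
  ext p
  exact mul_inv_cancel₀ (hd p).ne_zero

end Spectral

end Matrix

open Matrix in
theorem Gkappa_eq_inv_trace_inv {n : ℕ} {κ : ℝ} {M : Matrix (Fin n) (Fin n) ℝ}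
    (hM : M.IsHermitian) (hu : IsUnit (addCompoundTwo (M - κ • (1 : Matrix (Fin n) (Fin n) ℝ)))) :
    Gkappa n κ M =
      ((addCompoundTwo (M - κ • (1 : Matrix (Fin n) (Fin n) ℝ)))⁻¹.trace)⁻¹ := by
  rw [Gkappa, dif_pos hM, hM.trace_inv_addCompoundTwo hu]
  congr 1
  simp only [Finset.sum_filter]
  rw [← Fintype.sum_prod_type' (f := fun i j : Fin n =>
      if i < j then (hM.eigenvalues i + hM.eigenvalues j - 2 * κ)⁻¹ else 0), ← Finset.sum_filter]
  exact Finset.sum_subtype _ (by simp) _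

/-- Corollary 2.2: for a symmetric matrix `h` whose eigenvalues satisfy
`λᵢ + λⱼ > 2κ` for `i ≠ j` (equivalently `λ₁+λ₂ > 2κ`), and any symmetric `A`,
`d²/ds² G_κ(h+sA)|₀ ≤ 0`, with equality iff `A` is a scalar multiple of `h − κ·I`. -/
theorem stmt_6 (n : ℕ) (hn : 3 ≤ n) (κ : ℝ) (hκ : 0 ≤ κ)
    (h A : Matrix (Fin n) (Fin n) ℝ) (hh : h.IsHermitian) (hA : A.IsHermitian)
    (hdom : ∀ i j : Fin n, i ≠ j → hh.eigenvalues i + hh.eigenvalues j > 2 * κ) :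
    iteratedDeriv 2 (fun s : ℝ => Gkappa n κ (h + s • A)) 0 ≤ 0 ∧
    (iteratedDeriv 2 (fun s : ℝ => Gkappa n κ (h + s • A)) 0 = 0 ↔
      ∃ c : ℝ, A = c • (h - κ • (1 : Matrix (Fin n) (Fin n) ℝ))) := by
  have hK : (Matrix.addCompoundTwo (h - κ • (1 : Matrix (Fin n) (Fin n) ℝ))).PosDef :=
    hh.posDef_addCompoundTwo hdom
  have hB : (Matrix.addCompoundTwo A).IsHermitian := by
    rw [Matrix.IsHermitian, Matrix.conjTranspose_eq_transpose_of_trivial,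
      ← Matrix.addCompoundTwo_transpose, ← Matrix.conjTranspose_eq_transpose_of_trivial, hA.eq]
  have hlin : ∀ s : ℝ, Matrix.addCompoundTwo (h + s • A - κ • (1 : Matrix (Fin n) (Fin n) ℝ)) =
      Matrix.addCompoundTwo (h - κ • (1 : Matrix (Fin n) (Fin n) ℝ)) +
        s • Matrix.addCompoundTwo A := by
    intro s
    rw [← map_smul, ← map_add, add_sub_right_comm]
  have hev : (fun s : ℝ => Gkappa n κ (h + s • A)) =ᶠ[nhds 0] fun s =>
      ((Matrix.addCompoundTwo (h - κ • (1 : Matrix (Fin n) (Fin n) ℝ)) +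
        s • Matrix.addCompoundTwo A)⁻¹.trace)⁻¹ := by
    filter_upwards [Matrix.eventually_isUnit_add_smul _ (Matrix.addCompoundTwo A) hK.isUnit]
      with s hs
    rw [← hlin s] at hs ⊢
    exact Gkappa_eq_inv_trace_inv (hh.add (hA.smul (IsSelfAdjoint.all s))) hs
  have : Nonempty {p : Fin n × Fin n // p.1 < p.2} :=
    ⟨⟨(⟨0, by omega⟩, ⟨1, by omega⟩), by simp⟩⟩
  obtain ⟨hle, heq⟩ := hK.iteratedDeriv_two_inv_trace_inv hB
  rw [hev.iteratedDeriv_eq, heq]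
  refine ⟨hle, exists_congr fun c => ?_⟩
  rw [← map_smul, (Matrix.addCompoundTwo_injective (by simpa using hn)).eq_iff]
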